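/- Let W be a vector space over ℂ, let N and N₊ be seminorms on W with N(w) ≤ N₊(w) for all w ∈ W, let V ⊆ W be a linear subspace, and let B : W × W → ℂ be sesquilinear (linear in the first argument, conjugate-linear in the second). Assume: (i) Im B(v, v) ≥ N(v)² for all v ∈ V; (ii) there is C > 0 such that |B(w, v)| ≤ C N₊(w) N(v) for all w ∈ W and v ∈ V; (iii) u ∈ W and u_h ∈ V satisfy the Galerkin orthogonality B(u − u_h, v) = 0 for all v ∈ V. Then for every v ∈ V, N(u − u_h) ≤ (1 + C) N₊(u − v). -/

import Mathlib

/-- Abstract Céa-type quasi-optimality: if `B` is sesquilinear, coercive on the subspace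
`V` with respect to the seminorm `N`, continuous with respect to `N₊` and `N`, and
`u − u_h` is Galerkin-orthogonal to `V`, then `N(u − u_h) ≤ (1 + C) N₊(u − v)` for every
`v ∈ V`. -/
theorem cea_quasi_optimality (W : Type*) [AddCommGroup W] [Module ℂ W]
    (N Np : Seminorm ℂ W) (hNNp : ∀ w : W, N w ≤ Np w)
    (V : Submodule ℂ W)
    (B : W → W → ℂ)
    (hBadd₁ : ∀ u v w : W, B (u + v) w = B u w + B v w)
    (hBsmul₁ : ∀ (c : ℂ) (u w : W), B (c • u) w = c * B u w)
    (hBadd₂ : ∀ u v w : W, B u (v + w) = B u v + B u w)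
    (hBsmul₂ : ∀ (c : ℂ) (u w : W), B u (c • w) = (starRingEnd ℂ) c * B u w)
    (C : ℝ) (hC : 0 < C)
    (hcoer : ∀ v ∈ V, N v ^ 2 ≤ (B v v).im)
    (hcont : ∀ w : W, ∀ v ∈ V, ‖B w v‖ ≤ C * Np w * N v)
    (u uh : W) (huh : uh ∈ V)
    (hgal : ∀ v ∈ V, B (u - uh) v = 0) :
    ∀ v ∈ V, N (u - uh) ≤ (1 + C) * Np (u - v) := by
  intro v hv
  have he : v - uh ∈ V := V.sub_mem hv huh
  have hB : B (v - uh) (v - uh) = B (v - u) (v - uh) := by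
    have h := hBadd₁ (v - u) (u - uh) (v - uh)
    rwa [sub_add_sub_cancel, hgal _ he, add_zero] at h
  have hsq : N (v - uh) ^ 2 ≤ C * Np (u - v) * N (v - uh) :=
    calc N (v - uh) ^ 2 ≤ (B (v - u) (v - uh)).im := hB ▸ hcoer _ he
      _ ≤ ‖B (v - u) (v - uh)‖ := (le_abs_self _).trans (Complex.abs_im_le_norm _)
      _ ≤ C * Np (v - u) * N (v - uh) := hcont _ _ he
      _ = C * Np (u - v) * N (v - uh) := by rw [map_sub_rev Np]
  have hdiscrete : N (v - uh) ≤ C * Np (u - v) := by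
    rcases (apply_nonneg N (v - uh)).eq_or_lt with h | h
    · rw [← h]
      positivity
    · exact le_of_mul_le_mul_right (by rwa [← sq]) h
  calc N (u - uh) = N ((u - v) + (v - uh)) := by rw [sub_add_sub_cancel]
    _ ≤ N (u - v) + N (v - uh) := map_add_le_add N _ _
    _ ≤ Np (u - v) + C * Np (u - v) := add_le_add (hNNp _) hdiscrete
    _ = (1 + C) * Np (u - v) := by ring
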